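/- arXiv:2004.11097 — 4 statements merged into one kernel-verified Lean document; each statement's English description precedes it below -/
import Mathlib

section
/- Let j ≥ 0, let y ∈ ℂ^{2^{j+1}} with halves y_0, y_1 ∈ ℂ^{2^j}, let s = y_0 + y_1, and let ŷ = F_{2^{j+1}} y. Let 0 ≤ n_1 < n_2 < … < n_M < 2^j and suppose that every index ℓ ∈ {0,…,2^{j+1}−1} with y_ℓ ≠ 0 belongs to {n_1,…,n_M} ∪ {n_1+2^j,…,n_M+2^j}. Then for every h ∈ {0,…,2^j−1} the restricted linear relation Σ_{r=1}^{M} ω_{2^j}^{h n_r} · ω_{2^{j+1}}^{n_r} · (2 (y_0)_{n_r} − s_{n_r}) = ŷ_{2h+1} holds. -/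
/-- The Fourier matrix `F_N` with entries `ω_N^{jk}`, `ω_N = exp(-2πi/N)`. -/
noncomputable def fourierMat (N : ℕ) : Matrix (Fin N) (Fin N) ℂ :=
  Matrix.of fun j k =>
    Complex.exp (-2 * Real.pi * Complex.I * (((j : ℕ) * (k : ℕ) : ℕ) : ℂ) / ((N : ℕ) : ℂ))

lemma lt_two_pow_succ {j ℓ : ℕ} (h : ℓ < 2 ^ j) : ℓ < 2 ^ (j + 1) := by
  have h2 : 2 ^ (j + 1) = 2 * 2 ^ j := by rw [pow_succ]; ring
  omega

lemma add_lt_two_pow_succ {j ℓ : ℕ} (h : ℓ < 2 ^ j) : ℓ + 2 ^ j < 2 ^ (j + 1) := by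
  have h2 : 2 ^ (j + 1) = 2 * 2 ^ j := by rw [pow_succ]; ring
  omega

lemma two_mul_add_one_lt_two_pow_succ {j h : ℕ} (hh : h < 2 ^ j) :
    2 * h + 1 < 2 ^ (j + 1) := by
  have h2 : 2 ^ (j + 1) = 2 * 2 ^ j := by rw [pow_succ]; ring
  omega

/-- A sum over `Fin (2 ^ (j + 1))` splits into the sums over the two halves. -/
lemma sum_fin_two_pow_succ {A : Type*} [AddCommMonoid A] (j : ℕ) (f : Fin (2 ^ (j + 1)) → A) :
    ∑ ℓ, f ℓ = ∑ ℓ : Fin (2 ^ j),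
      (f ⟨ℓ.val, lt_two_pow_succ ℓ.isLt⟩ + f ⟨ℓ.val + 2 ^ j, add_lt_two_pow_succ ℓ.isLt⟩) := by
  have h2 : 2 ^ j + 2 ^ j = 2 ^ (j + 1) := by rw [pow_succ]; ring
  rw [← (finCongr h2).sum_comp, Fin.sum_univ_add, ← Finset.sum_add_distrib]
  refine Finset.sum_congr rfl fun ℓ _ => ?_
  congr 2
  exact Fin.ext (Nat.add_comm _ _)

/-- The entries of the odd rows of `F_{2^{j+1}}` in the first half of the columns. -/
lemma fourierMat_odd_left (j h ℓ : ℕ) (hh : h < 2 ^ j) (hℓ : ℓ < 2 ^ j) :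
    fourierMat (2 ^ (j + 1)) ⟨2 * h + 1, two_mul_add_one_lt_two_pow_succ hh⟩
        ⟨ℓ, lt_two_pow_succ hℓ⟩ =
      Complex.exp (-2 * Real.pi * Complex.I * ((h * ℓ : ℕ) : ℂ) / ((2 ^ j : ℕ) : ℂ)) *
        Complex.exp (-2 * Real.pi * Complex.I * (ℓ : ℂ) / ((2 ^ (j + 1) : ℕ) : ℂ)) := by
  rw [fourierMat, Matrix.of_apply, ← Complex.exp_add]
  congr 1
  have h2 : (2 : ℂ) ^ j ≠ 0 := pow_ne_zero _ two_ne_zero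
  push_cast
  rw [pow_succ]
  field_simp
  ring

/-- In the odd rows of `F_{2^{j+1}}`, the second half is the negative of the first half. -/
lemma fourierMat_odd_right (j h ℓ : ℕ) (hh : h < 2 ^ j) (hℓ : ℓ < 2 ^ j) :
    fourierMat (2 ^ (j + 1)) ⟨2 * h + 1, two_mul_add_one_lt_two_pow_succ hh⟩
        ⟨ℓ + 2 ^ j, add_lt_two_pow_succ hℓ⟩ =
      -fourierMat (2 ^ (j + 1)) ⟨2 * h + 1, two_mul_add_one_lt_two_pow_succ hh⟩
        ⟨ℓ, lt_two_pow_succ hℓ⟩ := by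
  simp only [fourierMat, Matrix.of_apply]
  rw [← Complex.exp_sub_pi_mul_I]
  refine Eq.trans ?_ (Complex.exp_periodic.sub_nat_mul_eq h)
  congr 1
  have h2 : (2 : ℂ) ^ j ≠ 0 := pow_ne_zero _ two_ne_zero
  push_cast
  rw [pow_succ]
  field_simp
  ring

/-- Let `y ∈ ℂ^{2^{j+1}}` with halves `y₀, y₁`, `s = y₀ + y₁` and
`ŷ = F_{2^{j+1}} y`.  If the support of `y` is contained in
`{n_1,…,n_M} ∪ {n_1+2^j,…,n_M+2^j}` where `0 ≤ n_1 < … < n_M < 2^j`, then for every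
`h ∈ {0,…,2^j−1}` the restricted relation
`∑_{r=1}^M ω_{2^j}^{h n_r} ω_{2^{j+1}}^{n_r} (2 (y₀)_{n_r} − s_{n_r}) = ŷ_{2h+1}` holds. -/
theorem restricted_odd_dft_relation (j M : ℕ)
    (n : Fin M → ℕ) (hmono : StrictMono n) (hn : ∀ r, n r < 2 ^ j)
    (y : Fin (2 ^ (j + 1)) → ℂ)
    (yhat : Fin (2 ^ (j + 1)) → ℂ) (hyhat : yhat = (fourierMat (2 ^ (j + 1))).mulVec y)
    (y0 y1 s : Fin (2 ^ j) → ℂ)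
    (hy0 : ∀ ℓ : Fin (2 ^ j), y0 ℓ = y ⟨ℓ.val, lt_two_pow_succ ℓ.isLt⟩)
    (hy1 : ∀ ℓ : Fin (2 ^ j), y1 ℓ = y ⟨ℓ.val + 2 ^ j, add_lt_two_pow_succ ℓ.isLt⟩)
    (hs : s = y0 + y1)
    (hsupp : ∀ ℓ : Fin (2 ^ (j + 1)), y ℓ ≠ 0 →
      ∃ r : Fin M, ℓ.val = n r ∨ ℓ.val = n r + 2 ^ j) :
    ∀ h : Fin (2 ^ j),
      ∑ r : Fin M,
          Complex.exp (-2 * Real.pi * Complex.I * (((h : ℕ) * n r : ℕ) : ℂ)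
              / ((2 ^ j : ℕ) : ℂ))
            * Complex.exp (-2 * Real.pi * Complex.I * ((n r : ℕ) : ℂ)
              / ((2 ^ (j + 1) : ℕ) : ℂ))
            * (2 * y0 ⟨n r, hn r⟩ - s ⟨n r, hn r⟩)
        = yhat ⟨2 * h.val + 1, two_mul_add_one_lt_two_pow_succ h.isLt⟩ := by
  intro h
  subst hyhat hs
  rw [Matrix.mulVec, dotProduct, sum_fin_two_pow_succ]
  have hinj : Function.Injective fun r => (⟨n r, hn r⟩ : Fin (2 ^ j)) := fun a b hab =>
    hmono.injective (congrArg Fin.val hab)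
  refine Fintype.sum_of_injective _ hinj _ _ (fun ℓ hℓ => ?_) (fun r => ?_)
  · have hne : ∀ r, ℓ.val ≠ n r := fun r hr => hℓ ⟨r, Fin.ext hr.symm⟩
    have hlt := ℓ.isLt
    have hleft : y ⟨ℓ.val, lt_two_pow_succ ℓ.isLt⟩ = 0 := by
      by_contra hy
      obtain ⟨r, hr | hr⟩ := hsupp _ hy
      · exact hne r hr
      · dsimp only at hr
        omega
    have hright : y ⟨ℓ.val + 2 ^ j, add_lt_two_pow_succ ℓ.isLt⟩ = 0 := by
      by_contra hy
      obtain ⟨r, hr | hr⟩ := hsupp _ hy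
      · have hlt' := hn r
        dsimp only at hr
        omega
      · exact hne r (Nat.add_right_cancel hr)
    rw [hleft, hright, mul_zero, mul_zero, add_zero]
  · rw [fourierMat_odd_right j h (n r) h.isLt (hn r),
      fourierMat_odd_left j h (n r) h.isLt (hn r), Pi.add_apply, hy0, hy1]
    ring
end

section
/- Let j ≥ 0, let 0 ≤ n_1 < n_2 < … < n_M < 2^j, and let h_1 < h_2 < … < h_M be indices in {0,…,2^j−1} such that the M×M matrix A = (ω_{2^{j+1}}^{(2h_p+1) n_r})_{p,r=1}^{M} is invertible. Let s ∈ ℂ^{2^j} be a vector whose support is contained in {n_1,…,n_M}. If y, z ∈ ℂ^{2^{j+1}} both satisfy: (i) y_ℓ + y_{ℓ+2^j} = s_ℓ and z_ℓ + z_{ℓ+2^j} = s_ℓ for all ℓ ∈ {0,…,2^j−1}; (ii) the supports of y and z are contained in {n_1,…,n_M} ∪ {n_1+2^j,…,n_M+2^j}; and (iii) (F_{2^{j+1}} y)_{2h_p+1} = (F_{2^{j+1}} z)_{2h_p+1} for all p = 1,…,M; then y = z. -/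
lemma Fin.sum_univ_two_pow_succ {R : Type*} [AddCommMonoid R] (j : ℕ) (f : Fin (2 ^ (j + 1)) → R) :
    ∑ k, f k = ∑ ℓ : Fin (2 ^ j),
      (f ⟨ℓ.val, lt_two_pow_succ ℓ.isLt⟩ + f ⟨ℓ.val + 2 ^ j, add_lt_two_pow_succ ℓ.isLt⟩) := by
  have e : 2 ^ j + 2 ^ j = 2 ^ (j + 1) := by ring
  rw [← (finCongr e).sum_comp, Fin.sum_univ_add, ← Finset.sum_add_distrib]
  refine Finset.sum_congr rfl fun ℓ _ => ?_
  congr 2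
  ext
  simp

lemma fourierMat_odd_add_half {j h k : ℕ} (hh : h < 2 ^ j) (hk : k < 2 ^ j) :
    fourierMat (2 ^ (j + 1)) ⟨2 * h + 1, two_mul_add_one_lt_two_pow_succ hh⟩
        ⟨k + 2 ^ j, add_lt_two_pow_succ hk⟩ =
      -fourierMat (2 ^ (j + 1)) ⟨2 * h + 1, two_mul_add_one_lt_two_pow_succ hh⟩
        ⟨k, lt_two_pow_succ hk⟩ := by
  simp only [fourierMat, Matrix.of_apply]
  rw [neg_eq_neg_one_mul (Complex.exp _), ← Complex.exp_pi_mul_I, ← Complex.exp_add,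
    Complex.exp_eq_exp_iff_exists_int]
  refine ⟨-(h : ℤ) - 1, ?_⟩
  have h2 : (2 : ℂ) ^ j ≠ 0 := pow_ne_zero j two_ne_zero
  push_cast
  rw [pow_succ]
  field_simp
  ring

/-- On vectors whose second half is minus the first half, the odd Fourier coefficients are
determined by the first half. -/
lemma fourierMat_mulVec_odd {j h : ℕ} (hh : h < 2 ^ j) (d : Fin (2 ^ (j + 1)) → ℂ)
    (hd : ∀ ℓ : Fin (2 ^ j), d ⟨ℓ.val + 2 ^ j, add_lt_two_pow_succ ℓ.isLt⟩ =
      -d ⟨ℓ.val, lt_two_pow_succ ℓ.isLt⟩) :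
    (fourierMat (2 ^ (j + 1))).mulVec d ⟨2 * h + 1, two_mul_add_one_lt_two_pow_succ hh⟩ =
      2 * ∑ ℓ : Fin (2 ^ j),
        fourierMat (2 ^ (j + 1)) ⟨2 * h + 1, two_mul_add_one_lt_two_pow_succ hh⟩
          ⟨ℓ.val, lt_two_pow_succ ℓ.isLt⟩ * d ⟨ℓ.val, lt_two_pow_succ ℓ.isLt⟩ := by
  rw [Matrix.mulVec, dotProduct, Fin.sum_univ_two_pow_succ, Finset.mul_sum]
  refine Finset.sum_congr rfl fun ℓ _ => ?_
  rw [hd, fourierMat_odd_add_half hh ℓ.isLt]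
  ring

/-- uniqueness of the reconstruction step.  With support indices
`0 ≤ n_1 < … < n_M < 2^j`, row indices `h_1 < … < h_M` in `{0,…,2^j−1}` such that
`A = (ω_{2^{j+1}}^{(2h_p+1) n_r})_{p,r}` is invertible, and `s ∈ ℂ^{2^j}` supported on
`{n_1,…,n_M}`: any two vectors `y, z ∈ ℂ^{2^{j+1}}` whose halves sum to `s`, whose
supports lie in `{n_r} ∪ {n_r + 2^j}` and whose DFTs agree at the entries `2h_p+1`
coincide. -/
theorem reconstruction_uniqueness (j M : ℕ)
    (n : Fin M → ℕ) (hnmono : StrictMono n) (hn : ∀ r, n r < 2 ^ j)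
    (h : Fin M → ℕ) (hhmono : StrictMono h) (hh : ∀ p, h p < 2 ^ j)
    (hA : IsUnit (Matrix.det (Matrix.of fun p r : Fin M =>
      Complex.exp (-2 * Real.pi * Complex.I * (((2 * h p + 1) * n r : ℕ) : ℂ)
        / ((2 ^ (j + 1) : ℕ) : ℂ)))))
    (s : Fin (2 ^ j) → ℂ)
    (hs_supp : ∀ ℓ : Fin (2 ^ j), s ℓ ≠ 0 → ∃ r : Fin M, ℓ.val = n r)
    (y z : Fin (2 ^ (j + 1)) → ℂ)
    (hy_sum : ∀ ℓ : Fin (2 ^ j),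
      y ⟨ℓ.val, lt_two_pow_succ ℓ.isLt⟩ + y ⟨ℓ.val + 2 ^ j, add_lt_two_pow_succ ℓ.isLt⟩ = s ℓ)
    (hz_sum : ∀ ℓ : Fin (2 ^ j),
      z ⟨ℓ.val, lt_two_pow_succ ℓ.isLt⟩ + z ⟨ℓ.val + 2 ^ j, add_lt_two_pow_succ ℓ.isLt⟩ = s ℓ)
    (hy_supp : ∀ ℓ : Fin (2 ^ (j + 1)), y ℓ ≠ 0 →
      ∃ r : Fin M, ℓ.val = n r ∨ ℓ.val = n r + 2 ^ j)
    (hz_supp : ∀ ℓ : Fin (2 ^ (j + 1)), z ℓ ≠ 0 →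
      ∃ r : Fin M, ℓ.val = n r ∨ ℓ.val = n r + 2 ^ j)
    (hFyz : ∀ p : Fin M,
      (fourierMat (2 ^ (j + 1))).mulVec y ⟨2 * h p + 1, two_mul_add_one_lt_two_pow_succ (hh p)⟩
        = (fourierMat (2 ^ (j + 1))).mulVec z
            ⟨2 * h p + 1, two_mul_add_one_lt_two_pow_succ (hh p)⟩) :
    y = z := by
  set d := y - z with hd_def
  have hd_anti (ℓ : Fin (2 ^ j)) : d ⟨ℓ.val + 2 ^ j, add_lt_two_pow_succ ℓ.isLt⟩ =
      -d ⟨ℓ.val, lt_two_pow_succ ℓ.isLt⟩ := by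
    simp only [hd_def, Pi.sub_apply]
    linear_combination hy_sum ℓ - hz_sum ℓ
  have hd_supp (ℓ : Fin (2 ^ j)) (hℓ : ∀ r, ℓ.val ≠ n r) :
      d ⟨ℓ.val, lt_two_pow_succ ℓ.isLt⟩ = 0 := by
    have hnot : ¬ ∃ r, ℓ.val = n r ∨ ℓ.val = n r + 2 ^ j := by
      rintro ⟨r, hr | hr⟩
      · exact hℓ r hr
      · have := ℓ.isLt
        omega
    simp only [hd_def, Pi.sub_apply]
    rw [not_not.1 fun hy => hnot (hy_supp _ hy), not_not.1 fun hz => hnot (hz_supp _ hz), sub_zero]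
  let ν (r : Fin M) : Fin (2 ^ j) := ⟨n r, hn r⟩
  have hν : Function.Injective ν := fun a b hab => hnmono.injective (congrArg Fin.val hab)
  have hdn : (fun r => d ⟨n r, lt_two_pow_succ (hn r)⟩) = 0 := by
    refine Matrix.eq_zero_of_mulVec_eq_zero hA.ne_zero (funext fun p => ?_)
    have hF := fourierMat_mulVec_odd (hh p) d hd_anti
    rw [hd_def, Matrix.mulVec_sub, Pi.sub_apply, hFyz p, sub_self, ← hd_def] at hF
    refine Eq.trans ?_ ((mul_eq_zero.1 hF.symm).resolve_left two_ne_zero)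
    refine Fintype.sum_of_injective ν hν _ _ (fun ℓ hℓ => ?_) fun r => rfl
    rw [hd_supp ℓ fun r hr => hℓ ⟨r, Fin.ext hr.symm⟩, mul_zero]
  have hd_half (ℓ : Fin (2 ^ j)) : d ⟨ℓ.val, lt_two_pow_succ ℓ.isLt⟩ = 0 := by
    by_cases hℓ : ∃ r, ℓ.val = n r
    · obtain ⟨r, hr⟩ := hℓ
      simpa only [hr, Pi.zero_apply] using congrFun hdn r
    · exact hd_supp ℓ (not_exists.1 hℓ)
  refine sub_eq_zero.1 (funext fun k => ?_)
  rcases lt_or_ge k.val (2 ^ j) with hk | hk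
  · exact hd_half ⟨k, hk⟩
  · have hk' : k.val - 2 ^ j < 2 ^ j := by
      have := k.isLt
      have := pow_succ 2 j
      omega
    have hkd := hd_anti ⟨k.val - 2 ^ j, hk'⟩
    rw [hd_half, neg_zero] at hkd
    simpa only [Nat.sub_add_cancel hk, Pi.zero_apply] using hkd
end

section
/- Let j ≥ 1, 1 ≤ M ≤ M' ≤ 2^j, let 0 ≤ n_1 < … < n_M < 2^j, and let σ ≥ 1 satisfy σ(n_k − n_ℓ) ≢ 0 (mod 2^j) for all k ≠ ℓ. For k = 1,…,M define S_k(σ) = Σ_{ℓ≠k} | sin( (M' π / 2^j) σ (n_k − n_ℓ) ) / sin( (π / 2^j) σ (n_k − n_ℓ) ) |. Then every eigenvalue μ of the Hermitian matrix W = V_{M',M}(σ)* V_{M',M}(σ) satisfies M' − max_k S_k(σ) ≤ μ ≤ M' + max_k S_k(σ). -/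
/-- The Vandermonde matrix `V_{M',M}(σ) = (ω_{2^j}^{σ p n_r})`, rows `p = 0,…,M'-1`,
columns `r = 1,…,M`, where `ω_{2^j} = exp(-2πi/2^j)`. -/
noncomputable def vandMat (j M' M σ : ℕ) (n : Fin M → ℕ) : Matrix (Fin M') (Fin M) ℂ :=
  Matrix.of fun p r =>
    Complex.exp (-2 * Real.pi * Complex.I * ((σ * (p : ℕ) * n r : ℕ) : ℂ)
      / ((2 ^ j : ℕ) : ℂ))

/-- The Dirichlet kernel formula for the modulus of a geometric sum on the unit circle. -/
theorem norm_geom_sum_exp_I (m : ℕ) {θ : ℝ} (hθ : Real.sin θ ≠ 0) :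
    ‖∑ p ∈ Finset.range m, Complex.exp (Complex.I * ((2 * θ : ℝ) : ℂ)) ^ p‖
      = |Real.sin (m * θ) / Real.sin θ| := by
  have hn : ∀ x : ℝ, ‖Complex.exp (Complex.I * ((2 * x : ℝ) : ℂ)) - 1‖ = 2 * |Real.sin x| := by
    intro x
    rw [Complex.norm_exp_I_mul_ofReal_sub_one, mul_div_cancel_left₀ x two_ne_zero, norm_mul,
      Real.norm_eq_abs, Real.norm_eq_abs, abs_two]
  have hne : Complex.exp (Complex.I * ((2 * θ : ℝ) : ℂ)) ≠ 1 := by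
    rw [← sub_ne_zero, ← norm_ne_zero_iff, hn]
    simpa using hθ
  have hpow : Complex.exp (Complex.I * ((2 * θ : ℝ) : ℂ)) ^ m
      = Complex.exp (Complex.I * ((2 * (m * θ) : ℝ) : ℂ)) := by
    rw [← Complex.exp_nat_mul]
    push_cast
    ring_nf
  rw [geom_sum_eq hne, hpow, norm_div, hn, hn, abs_div, mul_div_mul_left _ _ two_ne_zero]

theorem vandMat_gram_apply (j M' M σ : ℕ) (n : Fin M → ℕ) (k ℓ : Fin M) :
    ((vandMat j M' M σ n).conjTranspose * vandMat j M' M σ n) k ℓ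
      = ∑ p ∈ Finset.range M', Complex.exp (Complex.I *
          ((2 * (Real.pi / (2 : ℝ) ^ j * ((σ : ℝ) * ((n k : ℝ) - (n ℓ : ℝ)))) : ℝ) : ℂ)) ^ p := by
  rw [Matrix.mul_apply, Finset.sum_range]
  refine Finset.sum_congr rfl fun p _ => ?_
  rw [Matrix.conjTranspose_apply]
  simp only [vandMat, Matrix.of_apply]
  rw [← starRingEnd_apply, ← Complex.exp_conj, ← Complex.exp_add, ← Complex.exp_nat_mul]
  congr 1
  simp only [map_div₀, map_mul, map_neg, Complex.conj_ofReal, Complex.conj_I, map_ofNat,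
    Complex.conj_natCast]
  push_cast
  ring

theorem sin_pi_div_mul_intCast_ne_zero {N : ℕ} (hN : N ≠ 0) {a : ℤ} (ha : ¬ (N : ℤ) ∣ a) :
    Real.sin (Real.pi / N * a) ≠ 0 := by
  rw [Ne, Real.sin_eq_zero_iff]
  rintro ⟨c, hc⟩
  refine ha ⟨c, ?_⟩
  have hN' : (N : ℝ) ≠ 0 := Nat.cast_ne_zero.mpr hN
  have h : Real.pi * (a : ℝ) = Real.pi * (N * c) := by
    field_simp at hc
    linear_combination -Real.pi * hc
  exact_mod_cast mul_left_cancel₀ Real.pi_ne_zero h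

open scoped ComplexOrder in
theorem im_eq_zero_of_gram_mulVec_eq_smul {m n : Type*} [Fintype m] [Fintype n]
    (A : Matrix m n ℂ) {μ : ℂ} {u : n → ℂ} (hu : u ≠ 0)
    (h : (A.conjTranspose * A).mulVec u = μ • u) : μ.im = 0 := by
  have hpos : 0 < star u ⬝ᵥ u := Matrix.dotProduct_star_self_pos_iff.mpr hu
  have hnn := (Matrix.posSemidef_conjTranspose_mul_self A).dotProduct_mulVec_nonneg u
  rw [h, dotProduct_smul, smul_eq_mul] at hnn
  obtain ⟨hre, him⟩ := Complex.pos_iff.mp hpos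
  have hmul := (Complex.nonneg_iff.mp hnn).2
  rw [Complex.mul_im, ← him, mul_zero, zero_add] at hmul
  exact (mul_eq_zero.mp hmul.symm).resolve_right hre.ne'

/-- Gershgorin bound: with
`S_k(σ) = ∑_{ℓ≠k} |sin(M'π σ(n_k−n_ℓ)/2^j) / sin(π σ(n_k−n_ℓ)/2^j)|`, every
eigenvalue `μ` of the Hermitian matrix `W = V_{M',M}(σ)* V_{M',M}(σ)` is real and
satisfies `M' − max_k S_k(σ) ≤ μ ≤ M' + max_k S_k(σ)`. -/
theorem vandermonde_gram_eigenvalue_bound (j M M' : ℕ) (hj : 1 ≤ j) (hM : 1 ≤ M)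
    (hMM' : M ≤ M') (hM'2j : M' ≤ 2 ^ j)
    (σ : ℕ) (hσ1 : 1 ≤ σ)
    (n : Fin M → ℕ) (hmono : StrictMono n) (hn : ∀ r, n r < 2 ^ j)
    (hres : ∀ k ℓ : Fin M, k ≠ ℓ →
      ¬ ((2 ^ j : ℤ) ∣ (σ : ℤ) * ((n k : ℤ) - (n ℓ : ℤ))))
    (S : Fin M → ℝ)
    (hS : ∀ k : Fin M, S k = ∑ ℓ ∈ Finset.univ.erase k,
      |Real.sin ((M' : ℝ) * Real.pi / (2 : ℝ) ^ j * ((σ : ℝ) * ((n k : ℝ) - (n ℓ : ℝ))))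
        / Real.sin (Real.pi / (2 : ℝ) ^ j * ((σ : ℝ) * ((n k : ℝ) - (n ℓ : ℝ))))|) :
    ∀ (μ : ℂ) (u : Fin M → ℂ), u ≠ 0 →
      ((vandMat j M' M σ n).conjTranspose * vandMat j M' M σ n).mulVec u = μ • u →
      μ.im = 0
      ∧ (M' : ℝ) - (Finset.univ : Finset (Fin M)).sup' ⟨⟨0, hM⟩, Finset.mem_univ _⟩ S ≤ μ.re
      ∧ μ.re ≤ (M' : ℝ) + (Finset.univ : Finset (Fin M)).sup' ⟨⟨0, hM⟩, Finset.mem_univ _⟩ S := by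
  intro μ u hu hμu
  set W := (vandMat j M' M σ n).conjTranspose * vandMat j M' M σ n with hW
  have heig : Module.End.HasEigenvalue (Matrix.toLin' W) μ :=
    Module.End.hasEigenvalue_of_hasEigenvector
      (Module.End.hasEigenvector_iff.mpr
        ⟨Module.End.mem_eigenspace_iff.mpr (by rw [Matrix.toLin'_apply, hμu]), hu⟩)
  obtain ⟨k, hk⟩ := eigenvalue_mem_ball heig
  have hdiag : W k k = M' := by
    rw [hW, vandMat_gram_apply]
    simp
  have hrad : ∑ ℓ ∈ Finset.univ.erase k, ‖W k ℓ‖ = S k := by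
    rw [hS]
    refine Finset.sum_congr rfl fun ℓ hℓ => ?_
    have hsin := sin_pi_div_mul_intCast_ne_zero (N := 2 ^ j) (by positivity)
      (by exact_mod_cast hres k ℓ (Finset.ne_of_mem_erase hℓ).symm)
    push_cast at hsin
    rw [hW, vandMat_gram_apply, norm_geom_sum_exp_I M' hsin, ← mul_assoc, ← mul_div_assoc]
  rw [mem_closedBall_iff_norm, hdiag, hrad] at hk
  have hre := (Complex.abs_re_le_norm _).trans hk
  rw [Complex.sub_re, Complex.natCast_re, abs_le] at hre
  have hmax := Finset.le_sup' S (Finset.mem_univ k)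
  exact ⟨im_eq_zero_of_gram_mulVec_eq_smul _ hu hμu, by linarith, by linarith⟩
end

section
/- Let N = 2^J with J ≥ 1 and let x ∈ ℂ^N be such that Re(x_l) ≥ 0 and Im(x_l) ≥ 0 for all l = 0,…,N−1. Then for every j with 0 ≤ j < J and every n ∈ {0,…,2^j−1}: if x^{(j)}_n = 0, then both x^{(j+1)}_n = 0 and x^{(j+1)}_{n+2^j} = 0. Consequently, the support of x^{(j+1)} is contained in S ∪ (S + 2^j), where S is the support of x^{(j)}. -/
lemma periodize_idx_lt {J j k l : ℕ} (hj : j ≤ J) (hk : k < 2 ^ j) (hl : l < 2 ^ (J - j)) :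
    k + 2 ^ j * l < 2 ^ J := by
  have h : 2 ^ j * 2 ^ (J - j) = 2 ^ J := by rw [← pow_add]; congr 1; omega
  calc k + 2 ^ j * l < 2 ^ j + 2 ^ j * l := by omega
    _ = 2 ^ j * (l + 1) := by ring
    _ ≤ 2 ^ j * 2 ^ (J - j) := Nat.mul_le_mul_left _ hl
    _ = 2 ^ J := h

/-- The periodized vector `x^{(j)}` of `x ∈ ℂ^{2^J}`. -/
noncomputable def periodize (J j : ℕ) (hj : j ≤ J) (x : Fin (2 ^ J) → ℂ) :
    Fin (2 ^ j) → ℂ :=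
  fun k => ∑ l : Fin (2 ^ (J - j)),
    x ⟨k.val + 2 ^ j * l.val, periodize_idx_lt hj k.isLt l.isLt⟩

lemma eq_zero_of_sum_eq_zero_of_re_im_nonneg {ι : Type*} {s : Finset ι} {f : ι → ℂ}
    (hre : ∀ i ∈ s, 0 ≤ (f i).re) (him : ∀ i ∈ s, 0 ≤ (f i).im) (h : ∑ i ∈ s, f i = 0) :
    ∀ i ∈ s, f i = 0 := by
  have h_re : ∑ i ∈ s, (f i).re = 0 := by rw [← Complex.re_sum, h, Complex.zero_re]
  have h_im : ∑ i ∈ s, (f i).im = 0 := by rw [← Complex.im_sum, h, Complex.zero_im]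
  exact fun i hi => Complex.ext ((Finset.sum_eq_zero_iff_of_nonneg hre).1 h_re i hi)
    ((Finset.sum_eq_zero_iff_of_nonneg him).1 h_im i hi)

lemma periodize_eq_zero_iff {J j : ℕ} (hj : j ≤ J) {x : Fin (2 ^ J) → ℂ}
    (hre : ∀ l, 0 ≤ (x l).re) (him : ∀ l, 0 ≤ (x l).im) (n : Fin (2 ^ j)) :
    periodize J j hj x n = 0 ↔ ∀ i : Fin (2 ^ J), i.val % 2 ^ j = n.val → x i = 0 := by
  constructor
  · intro h i hi
    have hlt : i.val / 2 ^ j < 2 ^ (J - j) := by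
      rw [Nat.div_lt_iff_lt_mul (by positivity), ← pow_add, Nat.sub_add_cancel hj]
      exact i.isLt
    have hx := eq_zero_of_sum_eq_zero_of_re_im_nonneg (fun _ _ => hre _) (fun _ _ => him _) h
      ⟨i.val / 2 ^ j, hlt⟩ (Finset.mem_univ _)
    convert hx using 2
    apply Fin.ext
    simp only [← hi, Nat.mod_add_div]
  · intro h
    refine Finset.sum_eq_zero fun l _ => h _ ?_
    rw [Nat.add_mul_mod_self_left, Nat.mod_eq_of_lt n.isLt]

lemma periodize_succ_eq_zero {J j : ℕ} (hj : j < J) {x : Fin (2 ^ J) → ℂ}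
    (hre : ∀ l, 0 ≤ (x l).re) (him : ∀ l, 0 ≤ (x l).im) {n : Fin (2 ^ j)}
    {m : Fin (2 ^ (j + 1))} (hmn : m.val % 2 ^ j = n.val) (h : periodize J j hj.le x n = 0) :
    periodize J (j + 1) hj x m = 0 := by
  rw [periodize_eq_zero_iff hj.le hre him] at h
  rw [periodize_eq_zero_iff hj hre him]
  intro i hi
  refine h i ?_
  rw [← hmn, ← hi, Nat.mod_mod_of_dvd _ (pow_dvd_pow 2 j.le_succ)]

/-- if all components of `x ∈ ℂ^{2^J}` satisfy `Re x_l ≥ 0` and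
`Im x_l ≥ 0`, then for `0 ≤ j < J`: whenever `x^{(j)}_n = 0`, both
`x^{(j+1)}_n = 0` and `x^{(j+1)}_{n+2^j} = 0`.  Consequently, the support of
`x^{(j+1)}` is contained in `S ∪ (S + 2^j)`, where `S` is the support of `x^{(j)}`. -/
theorem periodize_support_doubling (J : ℕ) (hJ : 1 ≤ J) (x : Fin (2 ^ J) → ℂ)
    (hre : ∀ l : Fin (2 ^ J), 0 ≤ (x l).re) (him : ∀ l : Fin (2 ^ J), 0 ≤ (x l).im)
    (j : ℕ) (hj : j < J) :
    (∀ n : Fin (2 ^ j), periodize J j hj.le x n = 0 →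
        periodize J (j + 1) hj x ⟨n.val, lt_two_pow_succ n.isLt⟩ = 0
        ∧ periodize J (j + 1) hj x ⟨n.val + 2 ^ j, add_lt_two_pow_succ n.isLt⟩ = 0)
    ∧ ∀ m : Fin (2 ^ (j + 1)), periodize J (j + 1) hj x m ≠ 0 →
        ∃ n : Fin (2 ^ j), periodize J j hj.le x n ≠ 0
          ∧ (m.val = n.val ∨ m.val = n.val + 2 ^ j) := by
  refine ⟨fun n hn => ⟨periodize_succ_eq_zero hj hre him (Nat.mod_eq_of_lt n.isLt) hn,
    periodize_succ_eq_zero hj hre him ?_ hn⟩, fun m hm => ?_⟩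
  · rw [Nat.add_mod_right, Nat.mod_eq_of_lt n.isLt]
  · refine ⟨⟨m.val % 2 ^ j, Nat.mod_lt _ (by positivity)⟩,
      mt (periodize_succ_eq_zero hj hre him rfl) hm, ?_⟩
    have hlt : m.val < 2 ^ j * 2 := by rw [← pow_succ]; exact m.isLt
    rcases lt_or_ge m.val (2 ^ j) with h | h
    · exact Or.inl (Nat.mod_eq_of_lt h).symm
    · refine Or.inr (show m.val = m.val % 2 ^ j + 2 ^ j from ?_)
      rw [Nat.mod_eq_sub_mod h, Nat.mod_eq_of_lt (by omega)]
      omega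
end
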